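/- Let b₁(σ),…,b_m(σ) be arbitrary functions of the configuration σ taking values in [-1,1]. Then for any k ≥ 1 there is a constant C(m,k) depending only on m and k such that for any distinct indices 2 ≤ j₁,…,j_k ≤ N, E( g_{1j₁} g_{1j₂} ⋯ g_{1j_k} ⟨b₁⟩ ⟨b₂⟩ ⋯ ⟨b_m⟩ ) ≤ C(m,k) βᵏ / N^{k/2}. -/

import Mathlib

open MeasureTheory ProbabilityTheory Real Finset

namespace SK

/-- Index set of pairs `i < j` in `Fin N`. -/
abbrev Pairs (N : ℕ) := {p : Fin N × Fin N // p.1 < p.2}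

/-- The disorder: one real coordinate per pair. -/
abbrev Disorder (N : ℕ) := Pairs N → ℝ

/-- Law of the disorder: i.i.d. standard Gaussians. -/
noncomputable def μdis (N : ℕ) : Measure (Disorder N) :=
  Measure.pi fun _ => gaussianReal 0 1

/-- The symmetric extension `g_{ij}` of the disorder. -/
noncomputable def gval {N : ℕ} (G : Disorder N) (i j : Fin N) : ℝ :=
  if hij : i < j then G ⟨(i, j), hij⟩ else if hji : j < i then G ⟨(j, i), hji⟩ else 0

abbrev Config (N : ℕ) := Fin N → Bool

/-- Spins `±1`. -/
def spin (b : Bool) : ℝ := if b then 1 else -1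

/-- (Negative) Hamiltonian of the SK model. -/
noncomputable def ham {N : ℕ} (β h : ℝ) (G : Disorder N) (σ : Config N) : ℝ :=
  (β / Real.sqrt N) * ∑ p : Pairs N, G p * spin (σ p.1.1) * spin (σ p.1.2)
    + h * ∑ i, spin (σ i)

/-- Partition function. -/
noncomputable def Zpart {N : ℕ} (β h : ℝ) (G : Disorder N) : ℝ :=
  ∑ σ : Config N, Real.exp (ham β h G σ)

/-- Gibbs measure. -/
noncomputable def gibbs {N : ℕ} (β h : ℝ) (G : Disorder N) (σ : Config N) : ℝ :=
  Real.exp (ham β h G σ) / Zpart β h G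

/-- Quenched average of a function of one replica. -/
noncomputable def qavg {N : ℕ} (β h : ℝ) (G : Disorder N) (f : Config N → ℝ) : ℝ :=
  ∑ σ : Config N, f σ * gibbs β h G σ

/-- Quenched average of a function of two replicas. -/
noncomputable def qavg2 {N : ℕ} (β h : ℝ) (G : Disorder N)
    (f : Config N → Config N → ℝ) : ℝ :=
  ∑ σ1 : Config N, ∑ σ2 : Config N, f σ1 σ2 * gibbs β h G σ1 * gibbs β h G σ2

/-- Overlap of two configurations. -/
noncomputable def overlap {N : ℕ} (σ1 σ2 : Config N) : ℝ :=
  (1 / (N : ℝ)) * ∑ i, spin (σ1 i) * spin (σ2 i)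

/-- The high temperature condition `E⟨(R₁₂ - q)⁴⟩ ≤ K/N²`. -/
def highTemp (N : ℕ) (β h q K : ℝ) : Prop :=
  ∫ G, qavg2 β h G (fun σ1 σ2 => (overlap σ1 σ2 - q) ^ 4) ∂(μdis N) ≤ K / (N : ℝ) ^ 2

/-- Magnetization `⟨σ_i⟩`. -/
noncomputable def mavg {N : ℕ} (β h : ℝ) (G : Disorder N) (i : Fin N) : ℝ :=
  qavg β h G fun σ => spin (σ i)

/-- Local field `ℓ_i`. -/
noncomputable def locField {N : ℕ} (G : Disorder N) (i : Fin N) (σ : Config N) : ℝ :=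
  (1 / Real.sqrt N) * ∑ j ∈ Finset.univ.erase i, gval G i j * spin (σ j)

/-- The field `r_i`. -/
noncomputable def rfield {N : ℕ} (β h q : ℝ) (G : Disorder N) (i : Fin N) : ℝ :=
  (1 / Real.sqrt N) * ∑ j ∈ Finset.univ.erase i, gval G i j * mavg β h G j
    - β * (1 - q) * mavg β h G i

/-- Gaussian density `φ_{μ,v}` with mean `μ` and variance `v`. -/
noncomputable def gaussDens (μ v x : ℝ) : ℝ :=
  (1 / (Real.sqrt (2 * π) * Real.sqrt v)) * Real.exp (-(x - μ) ^ 2 / (2 * v))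

/-- Mixture-Gaussian density `ψ_{a,b,μ,v}`. -/
noncomputable def mixDens (a b μ v x : ℝ) : ℝ :=
  Real.cosh (a * x + b) * Real.exp (-(x - μ) ^ 2 / (2 * v)) /
    (Real.sqrt (2 * π) * Real.sqrt v * Real.cosh (a * μ + b) * Real.exp (a ^ 2 * v / 2))


/-- Gaussian integration by parts on the real line, for bounded functions with bounded derivative. -/
theorem integral_id_mul_gaussianReal {f f' : ℝ → ℝ} {A B : ℝ}
    (hf : ∀ x, HasDerivAt f (f' x) x) (hf' : Measurable f')
    (hA : ∀ x, |f x| ≤ A) (hB : ∀ x, |f' x| ≤ B) :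
    ∫ x, x * f x ∂(gaussianReal 0 1) = ∫ x, f' x ∂(gaussianReal 0 1) := by
  have hcont : Continuous f := continuous_iff_continuousAt.2 fun x => (hf x).continuousAt
  have hpdf : Integrable (gaussianPDFReal 0 1) := integrable_gaussianPDFReal 0 1
  have hpdf_id : Integrable (fun x => x * gaussianPDFReal 0 1 x) := by
    have h := (integrable_mul_exp_neg_mul_sq (b := 1 / 2) (by norm_num)).const_mul
      ((√(2 * π * (1 : NNReal)))⁻¹)
    refine h.congr (Filter.Eventually.of_forall fun x => ?_)
    simp only [gaussianPDFReal]
    rw [show -(x - 0) ^ 2 / (2 * ((1 : NNReal) : ℝ)) = -(1 / 2) * x ^ 2 by push_cast; ring]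
    ring
  have hderiv : ∀ x, HasDerivAt (fun x => -gaussianPDFReal 0 1 x) (x * gaussianPDFReal 0 1 x) x := by
    intro x
    have h1 : HasDerivAt (fun y : ℝ => -(y - 0) ^ 2 / (2 * ((1 : NNReal) : ℝ))) (-x) x := by
      have := (((hasDerivAt_id x).sub_const 0).pow 2).neg.div_const (2 * ((1 : NNReal) : ℝ))
      refine this.congr_deriv ?_
      simp
      ring
    refine ((h1.exp.const_mul ((√(2 * π * (1 : NNReal)))⁻¹)).neg).congr_deriv ?_
    simp only [gaussianPDFReal]
    ring
  rw [integral_gaussianReal_eq_integral_smul one_ne_zero,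
    integral_gaussianReal_eq_integral_smul one_ne_zero]
  have key := integral_mul_deriv_eq_deriv_mul_of_integrable (u := f) (u' := f')
    (v := fun x => -gaussianPDFReal 0 1 x) (v' := fun x => x * gaussianPDFReal 0 1 x)
    (fun x _ => hf x) (fun x _ => hderiv x)
    (hpdf_id.bdd_mul hcont.aestronglyMeasurable (Filter.Eventually.of_forall hA))
    (hpdf.neg.bdd_mul hf'.aestronglyMeasurable (Filter.Eventually.of_forall hB))
    (hpdf.neg.bdd_mul hcont.aestronglyMeasurable (Filter.Eventually.of_forall hA))
  calc ∫ x, gaussianPDFReal 0 1 x • (x * f x)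
      = ∫ x, f x * (x * gaussianPDFReal 0 1 x) := by
        congr 1; ext x; simp only [smul_eq_mul]; ring
    _ = -∫ x, f' x * -gaussianPDFReal 0 1 x := key
    _ = ∫ x, gaussianPDFReal 0 1 x • f' x := by
        rw [← integral_neg]; congr 1; ext x; simp only [smul_eq_mul]; ring

/-- Resampling one coordinate preserves a product probability measure. -/
theorem measurePreserving_update {ι : Type*} [Fintype ι] [DecidableEq ι] {X : ι → Type*}
    [∀ i, MeasurableSpace (X i)] (μ : ∀ i, Measure (X i)) [∀ i, IsProbabilityMeasure (μ i)]
    (i : ι) :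
    MeasurePreserving (fun q : (∀ i, X i) × X i => Function.update q.1 i q.2)
      ((Measure.pi μ).prod (μ i)) (Measure.pi μ) := by
  have hmeas : Measurable (fun q : (∀ i, X i) × X i => Function.update q.1 i q.2) :=
    measurable_update'
  refine ⟨hmeas, (Measure.pi_eq fun s hs => ?_).symm⟩
  have hpre : (fun q : (∀ i, X i) × X i => Function.update q.1 i q.2) ⁻¹' Set.univ.pi s
      = (Set.univ.pi (Function.update s i Set.univ)) ×ˢ s i := by
    ext ⟨G, x⟩
    simp only [Set.mem_preimage, Set.mem_pi, Set.mem_univ, true_imp_iff, Set.mem_prod]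
    constructor
    · refine fun H => ⟨fun l => ?_, by simpa using H i⟩
      rcases eq_or_ne l i with rfl | hl
      · simp
      · simpa [hl] using H l
    · rintro ⟨H, hx⟩ l
      rcases eq_or_ne l i with rfl | hl
      · simpa using hx
      · simpa [hl] using H l
  rw [Measure.map_apply hmeas (MeasurableSet.univ_pi hs), hpre, Measure.prod_prod, Measure.pi_pi,
    ← Finset.prod_erase_mul _ _ (Finset.mem_univ i),
    ← Finset.prod_erase_mul Finset.univ (fun l => μ l (s l)) (Finset.mem_univ i)]
  congr 1
  rw [Function.update_self, measure_univ, mul_one]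
  refine Finset.prod_congr rfl fun l hl => ?_
  rw [Function.update_of_ne (Finset.ne_of_mem_erase hl)]

/-- Gaussian integration by parts in one coordinate of a standard Gaussian vector, with an
integrable factor that does not depend on that coordinate. -/
theorem integral_coord_mul_pi_gaussianReal {ι : Type*} [Fintype ι] [DecidableEq ι] (i : ι)
    {Φ F F' : (ι → ℝ) → ℝ} {A B : ℝ}
    (hΦ : ∀ G x, Φ (Function.update G i x) = Φ G)
    (hF : ∀ G x, HasDerivAt (fun y => F (Function.update G i y)) (F' (Function.update G i x)) x)
    (hFm : Measurable F) (hF'm : Measurable F')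
    (hA : ∀ G, |F G| ≤ A) (hB : ∀ G, |F' G| ≤ B)
    (hΦint : Integrable Φ (Measure.pi fun _ : ι => gaussianReal 0 1))
    (hΦint' : Integrable (fun G => G i * Φ G) (Measure.pi fun _ : ι => gaussianReal 0 1)) :
    ∫ G, G i * Φ G * F G ∂(Measure.pi fun _ : ι => gaussianReal 0 1)
      = ∫ G, Φ G * F' G ∂(Measure.pi fun _ : ι => gaussianReal 0 1) := by
  have hmp := measurePreserving_update (fun _ : ι => gaussianReal 0 1) i
  have resample : ∀ {H : (ι → ℝ) → ℝ},
      Integrable H (Measure.pi fun _ : ι => gaussianReal 0 1) →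
      ∫ G, H G ∂(Measure.pi fun _ : ι => gaussianReal 0 1)
        = ∫ G, ∫ x, H (Function.update G i x) ∂(gaussianReal 0 1)
            ∂(Measure.pi fun _ : ι => gaussianReal 0 1) := by
    intro H hH
    have hcomp := hmp.integrable_comp_of_integrable hH
    refine Eq.trans ?_ (integral_prod _ hcomp)
    conv_lhs => rw [← hmp.map_eq]
    exact integral_map hmp.measurable.aemeasurable (by rw [hmp.map_eq]; exact hH.1)
  rw [resample (hΦint'.mul_bdd hFm.aestronglyMeasurable (Filter.Eventually.of_forall hA)),
    resample (hΦint.mul_bdd hF'm.aestronglyMeasurable (Filter.Eventually.of_forall hB))]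
  congr 1
  ext G
  simp only [hΦ, Function.update_self]
  rw [integral_const_mul, ← integral_id_mul_gaussianReal (fun x => hF G x)
    (hF'm.comp (measurable_update G)) (fun _ => hA _) (fun _ => hB _), ← integral_const_mul]
  congr 1
  ext x
  ring

theorem abs_spin (b : Bool) : |spin b| = 1 := by
  cases b <;> simp [spin]

/-- The product of the two spins of a pair. -/
def pairSpin {N : ℕ} (p : Pairs N) (σ : Config N) : ℝ :=
  spin (σ p.1.1) * spin (σ p.1.2)

theorem abs_pairSpin {N : ℕ} (p : Pairs N) (σ : Config N) : |pairSpin p σ| = 1 := by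
  simp [pairSpin, abs_mul, abs_spin]

theorem Zpart_pos {N : ℕ} (β h : ℝ) (G : Disorder N) : 0 < Zpart β h G :=
  Finset.sum_pos (fun _ _ => Real.exp_pos _) Finset.univ_nonempty

theorem gibbs_nonneg {N : ℕ} (β h : ℝ) (G : Disorder N) (σ : Config N) : 0 ≤ gibbs β h G σ :=
  div_nonneg (Real.exp_pos _).le (Zpart_pos β h G).le

theorem sum_gibbs {N : ℕ} (β h : ℝ) (G : Disorder N) : ∑ σ, gibbs β h G σ = 1 := by
  simp only [gibbs]
  rw [← Finset.sum_div]
  exact div_self (Zpart_pos β h G).ne'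

theorem continuous_gibbs {N : ℕ} (β h : ℝ) (σ : Config N) :
    Continuous fun G => gibbs β h G σ := by
  have hham : ∀ ρ : Config N, Continuous fun G => ham β h G ρ := by
    intro ρ
    unfold ham
    fun_prop
  unfold gibbs
  refine (hham σ).rexp.div ?_ fun G => (Zpart_pos β h G).ne'
  unfold Zpart
  exact continuous_finsetSum _ fun ρ _ => (hham ρ).rexp

theorem hasDerivAt_ham {N : ℕ} (β h : ℝ) (G : Disorder N) (p : Pairs N) (σ : Config N) (x : ℝ) :
    HasDerivAt (fun y => ham β h (Function.update G p y) σ)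
      (β / Real.sqrt N * pairSpin p σ) x := by
  have hcoord : ∀ q : Pairs N, HasDerivAt
      (fun y => Function.update G p y q * spin (σ q.1.1) * spin (σ q.1.2))
      ((Pi.single p (1 : ℝ) : Pairs N → ℝ) q * spin (σ q.1.1) * spin (σ q.1.2)) x :=
    fun q => ((hasDerivAt_pi.1 (hasDerivAt_update G p x) q).mul_const _).mul_const _
  unfold ham
  refine (((HasDerivAt.fun_sum fun q (_ : q ∈ Finset.univ) => hcoord q).const_mul
    (β / Real.sqrt N)).add_const _).congr_deriv ?_
  congr 1
  rw [Finset.sum_eq_single p]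
  · simp [pairSpin]
  · intro q _ hq
    simp [hq]
  · simp

theorem hasDerivAt_gibbs {N : ℕ} (β h : ℝ) (G : Disorder N) (p : Pairs N) (σ : Config N) (x : ℝ) :
    HasDerivAt (fun y => gibbs β h (Function.update G p y) σ)
      (gibbs β h (Function.update G p x) σ * (β / Real.sqrt N *
        (pairSpin p σ - qavg β h (Function.update G p x) (pairSpin p)))) x := by
  have hexp := fun ρ : Config N => (hasDerivAt_ham β h G p ρ x).exp
  have hZ : HasDerivAt (fun y => Zpart β h (Function.update G p y))
      (∑ ρ, Real.exp (ham β h (Function.update G p x) ρ) *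
        (β / Real.sqrt N * pairSpin p ρ)) x :=
    HasDerivAt.fun_sum fun ρ _ => hexp ρ
  have hZ0 := (Zpart_pos β h (Function.update G p x)).ne'
  refine ((hexp σ).div hZ hZ0).congr_deriv ?_
  have hq : ∑ ρ, Real.exp (ham β h (Function.update G p x) ρ) * (β / Real.sqrt N * pairSpin p ρ)
      = Zpart β h (Function.update G p x) * (β / Real.sqrt N *
          qavg β h (Function.update G p x) (pairSpin p)) := by
    simp only [qavg, gibbs, Finset.mul_sum]
    refine Finset.sum_congr rfl fun ρ _ => ?_
    field_simp
  rw [hq, gibbs]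
  field_simp

/-- Quenched average of a function of `m` replicas. -/
noncomputable def replicaAvg {N m : ℕ} (β h : ℝ) (G : Disorder N)
    (f : (Fin m → Config N) → ℝ) : ℝ :=
  ∑ τ, f τ * ∏ l, gibbs β h G (τ l)

theorem prod_qavg {N m : ℕ} (β h : ℝ) (G : Disorder N) (b : Fin m → Config N → ℝ) :
    ∏ l, qavg β h G (b l) = replicaAvg β h G fun τ => ∏ l, b l (τ l) := by
  simp only [qavg, replicaAvg, Finset.prod_univ_sum, Fintype.piFinset_univ,
    Finset.prod_mul_distrib]

theorem abs_replicaAvg_le {N m : ℕ} (β h : ℝ) (G : Disorder N) {f : (Fin m → Config N) → ℝ}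
    {A : ℝ} (hf : ∀ τ, |f τ| ≤ A) : |replicaAvg β h G f| ≤ A := by
  have hone : ∑ τ : Fin m → Config N, ∏ l, gibbs β h G (τ l) = 1 := by
    have := Finset.prod_univ_sum (fun _ : Fin m => (Finset.univ : Finset (Config N)))
      (fun _ σ => gibbs β h G σ)
    simpa [sum_gibbs] using this.symm
  calc |replicaAvg β h G f| ≤ ∑ τ, |f τ * ∏ l, gibbs β h G (τ l)| :=
        Finset.abs_sum_le_sum_abs _ _
    _ ≤ ∑ τ : Fin m → Config N, A * ∏ l, gibbs β h G (τ l) := by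
        refine Finset.sum_le_sum fun τ _ => ?_
        have hw : 0 ≤ ∏ l, gibbs β h G (τ l) :=
          Finset.prod_nonneg fun l _ => gibbs_nonneg β h G (τ l)
        rw [abs_mul, abs_of_nonneg hw]
        exact mul_le_mul_of_nonneg_right (hf τ) hw
    _ = A := by rw [← Finset.mul_sum, hone, mul_one]

theorem continuous_replicaAvg {N m : ℕ} (β h : ℝ) (f : (Fin m → Config N) → ℝ) :
    Continuous fun G : Disorder N => replicaAvg β h G f :=
  continuous_finsetSum _ fun τ _ =>
    continuous_const.mul (continuous_finsetProd _ fun l _ => continuous_gibbs β h (τ l))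

/-- The function of `m + 1` replicas whose average is the derivative, in the coordinate `p` of the
disorder, of the average of `f`. The extra replica has index `0`. -/
noncomputable def replicaDeriv {N m : ℕ} (β : ℝ) (p : Pairs N) (f : (Fin m → Config N) → ℝ)
    (τ : Fin (m + 1) → Config N) : ℝ :=
  β / Real.sqrt N * (f (Fin.tail τ) * ∑ l : Fin m, (pairSpin p (τ l.succ) - pairSpin p (τ 0)))

theorem abs_replicaDeriv_le {N m : ℕ} {β : ℝ} (hβ : 0 ≤ β) (p : Pairs N)
    {f : (Fin m → Config N) → ℝ} {A : ℝ} (hf : ∀ τ, |f τ| ≤ A) (τ : Fin (m + 1) → Config N) :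
    |replicaDeriv β p f τ| ≤ β / Real.sqrt N * (A * (2 * m)) := by
  have hsum : |∑ l : Fin m, (pairSpin p (τ l.succ) - pairSpin p (τ 0))| ≤ 2 * m := by
    calc |∑ l : Fin m, (pairSpin p (τ l.succ) - pairSpin p (τ 0))|
        ≤ ∑ l : Fin m, |pairSpin p (τ l.succ) - pairSpin p (τ 0)| :=
          Finset.abs_sum_le_sum_abs _ _
      _ ≤ ∑ _l : Fin m, (2 : ℝ) := by
          refine Finset.sum_le_sum fun l _ => (abs_sub _ _).trans ?_
          rw [abs_pairSpin, abs_pairSpin]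
          norm_num
      _ = 2 * m := by simp [mul_comm]
  have hc : 0 ≤ β / Real.sqrt N := div_nonneg hβ (Real.sqrt_nonneg _)
  rw [replicaDeriv, abs_mul, abs_of_nonneg hc, abs_mul]
  exact mul_le_mul_of_nonneg_left (mul_le_mul (hf _) hsum (abs_nonneg _)
    ((abs_nonneg _).trans (hf (Fin.tail τ)))) hc

theorem replicaAvg_replicaDeriv {N m : ℕ} (β h : ℝ) (G : Disorder N) (p : Pairs N)
    (f : (Fin m → Config N) → ℝ) :
    replicaAvg β h G (replicaDeriv β p f) =
      ∑ τ, f τ * ((∏ l, gibbs β h G (τ l)) *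
        ∑ l, β / Real.sqrt N * (pairSpin p (τ l) - qavg β h G (pairSpin p))) := by
  rw [replicaAvg, ← (Fin.consEquiv fun _ : Fin (m + 1) => Config N).sum_comp,
    Fintype.sum_prod_type_right]
  refine Finset.sum_congr rfl fun τ _ => ?_
  have hg := sum_gibbs β h G
  have htail : ∀ σ : Config N,
      Fin.tail ((Fin.consEquiv fun _ : Fin (m + 1) => Config N) (σ, τ)) = τ := fun _ => rfl
  simp only [replicaDeriv, htail, Fin.consEquiv_apply, Fin.prod_univ_succ, Fin.cons_zero,
    Fin.cons_succ]
  set W := ∏ l, gibbs β h G (τ l)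
  have hsplit : ∀ σ : Config N,
      β / Real.sqrt N * (f τ * ∑ l : Fin m, (pairSpin p (τ l) - pairSpin p σ))
          * (gibbs β h G σ * W)
        = β / Real.sqrt N * f τ * W * ((∑ l, pairSpin p (τ l)) * gibbs β h G σ
          - m * (pairSpin p σ * gibbs β h G σ)) := by
    intro σ
    rw [Finset.sum_sub_distrib]
    simp only [Finset.sum_const, Finset.card_univ, Fintype.card_fin, nsmul_eq_mul]
    ring
  rw [Finset.sum_congr rfl fun σ _ => hsplit σ, ← Finset.mul_sum, Finset.sum_sub_distrib,
    ← Finset.mul_sum, ← Finset.mul_sum, hg, ← Finset.mul_sum, Finset.sum_sub_distrib]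
  simp only [Finset.sum_const, Finset.card_univ, Fintype.card_fin, nsmul_eq_mul, qavg]
  ring

theorem hasDerivAt_replicaAvg {N m : ℕ} (β h : ℝ) (G : Disorder N) (p : Pairs N)
    (f : (Fin m → Config N) → ℝ) (x : ℝ) :
    HasDerivAt (fun y => replicaAvg β h (Function.update G p y) f)
      (replicaAvg β h (Function.update G p x) (replicaDeriv β p f)) x := by
  rw [replicaAvg_replicaDeriv]
  refine HasDerivAt.fun_sum fun τ _ => HasDerivAt.const_mul _ ?_
  refine (HasDerivAt.fun_finsetProd fun l _ => hasDerivAt_gibbs β h G p (τ l) x).congr_deriv ?_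
  rw [Finset.mul_sum]
  refine Finset.sum_congr rfl fun l hl => ?_
  rw [← Finset.prod_erase_mul _ _ hl, smul_eq_mul, mul_assoc]

theorem integrable_prod_coord {N k : ℕ} {p : Fin k → Pairs N} (hp : Function.Injective p) :
    Integrable (fun G : Disorder N => ∏ l, G (p l)) (μdis N) := by
  have hcoord : ∀ q : Pairs N,
      Integrable (fun x : ℝ => if q ∈ Finset.univ.image p then x else 1) (gaussianReal 0 1) := by
    intro q
    split_ifs
    · exact (memLp_id_gaussianReal 1).integrable le_rfl
    · exact integrable_const 1
  have hint := Integrable.fintype_prod hcoord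
  refine hint.congr (Filter.Eventually.of_forall fun G => ?_)
  simp only
  rw [Finset.prod_ite_mem, Finset.univ_inter, Finset.prod_image fun a _ b _ hab => hp hab]

/-- A product of `k` distinct coordinates of the disorder against a bounded function of `m`
replicas has expectation of order `(β / √N) ^ k`. -/
theorem exists_abs_integral_prod_mul_replicaAvg_le (k : ℕ) : ∀ m : ℕ,
    ∃ C : ℝ, 0 ≤ C ∧ ∀ (N : ℕ) (β h : ℝ), 0 ≤ β → ∀ (A : ℝ) (f : (Fin m → Config N) → ℝ),
      (∀ τ, |f τ| ≤ A) → ∀ p : Fin k → Pairs N, Function.Injective p →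
        |∫ G, (∏ l, G (p l)) * replicaAvg β h G f ∂(μdis N)|
          ≤ C * (A * (β / Real.sqrt N) ^ k) := by
  induction k with
  | zero =>
    refine fun m => ⟨1, zero_le_one, fun N β h _ A f hf p _ => ?_⟩
    have : IsProbabilityMeasure (μdis N) := by unfold μdis; infer_instance
    have hbound := norm_integral_le_of_norm_le_const (μ := μdis N)
      (f := fun G => replicaAvg β h G f)
      (Filter.Eventually.of_forall fun G => abs_replicaAvg_le β h G hf)
    simpa using hbound
  | succ k ih =>
    intro m
    obtain ⟨C, hC, hbound⟩ := ih (m + 1)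
    refine ⟨C * (2 * m), by positivity, fun N β h hβ A f hf p hp => ?_⟩
    have htail : Function.Injective fun l : Fin k => p l.succ :=
      hp.comp (Fin.succ_injective k)
    have hderiv := abs_replicaDeriv_le hβ (p 0) hf
    have hparts := integral_coord_mul_pi_gaussianReal (p 0)
      (Φ := fun G : Disorder N => ∏ l : Fin k, G (p l.succ))
      (F := fun G => replicaAvg β h G f)
      (F' := fun G => replicaAvg β h G (replicaDeriv β (p 0) f))
      (fun G x => Finset.prod_congr rfl fun l _ =>
        Function.update_of_ne (fun e => Fin.succ_ne_zero l (hp e)) x G)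
      (fun G x => hasDerivAt_replicaAvg β h G (p 0) f x)
      (continuous_replicaAvg β h f).measurable
      (continuous_replicaAvg β h _).measurable
      (fun G => abs_replicaAvg_le β h G hf)
      (fun G => abs_replicaAvg_le β h G hderiv)
      (integrable_prod_coord htail)
      ((integrable_prod_coord hp).congr
        (Filter.Eventually.of_forall fun G => Fin.prod_univ_succ fun l => G (p l)))
    simp only [Fin.prod_univ_succ]
    rw [μdis, hparts]
    refine (hbound N β h hβ _ _ hderiv _ htail).trans_eq ?_
    ring

/-- Lemma 3.2: moment bounds for products of disorder variables in the first
row with quenched averages of bounded functions. -/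
theorem moment_expansion_bound (m k : ℕ) (hk : 1 ≤ k) :
    ∃ C : ℝ, 0 < C ∧ ∀ (N : ℕ) (hN : 2 ≤ N) (β h : ℝ), 0 < β →
      ∀ b : Fin m → Config N → ℝ, (∀ l σ, |b l σ| ≤ 1) →
      ∀ j : Fin k → Fin N, Function.Injective j →
        (∀ l, j l ≠ (⟨0, by omega⟩ : Fin N)) →
        ∫ G, (∏ l : Fin k, gval G (⟨0, by omega⟩ : Fin N) (j l))
            * ∏ l' : Fin m, qavg β h G (b l') ∂(μdis N)
        ≤ C * β ^ k / Real.sqrt N ^ k := by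
  obtain ⟨C, hC, hbound⟩ := exists_abs_integral_prod_mul_replicaAvg_le k m
  refine ⟨C + 1, by positivity, fun N hN β h hβ b hb j hj hj0 => ?_⟩
  have hpos : ∀ l, (⟨0, by omega⟩ : Fin N) < j l := fun l =>
    lt_of_le_of_ne (Fin.mk_le_of_le_val (Nat.zero_le _)) (hj0 l).symm
  have hinj : Function.Injective fun l => (⟨(⟨0, by omega⟩, j l), hpos l⟩ : Pairs N) := by
    intro a c hac
    simp only [Subtype.mk.injEq, Prod.mk.injEq, true_and] at hac
    exact hj hac
  have hprod : ∀ τ : Fin m → Config N, |∏ l, b l (τ l)| ≤ 1 := by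
    intro τ
    rw [Finset.abs_prod]
    exact Finset.prod_le_one (fun _ _ => abs_nonneg _) fun l _ => hb l (τ l)
  have hgval : ∀ (G : Disorder N) l, gval G (⟨0, by omega⟩ : Fin N) (j l)
      = G ⟨(⟨0, by omega⟩, j l), hpos l⟩ := fun G l => dif_pos (hpos l)
  simp only [hgval, prod_qavg]
  refine (le_abs_self _).trans ((hbound N β h hβ.le 1 _ hprod _ hinj).trans ?_)
  rw [one_mul, mul_div_assoc, ← div_pow]
  exact mul_le_mul_of_nonneg_right (by linarith) (by positivity)

end SK
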